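/- Assume n ≥ 2. For every lattice point t of (n−2)Δ^{d−1}, the tree-linkage graph G(t) is a spanning tree of the vertex set [d̄]: it is connected and acyclic (hence has exactly d − 1 edges). -/

import Mathlib

open Finset

/-- A bipartite graph between `α` and `β`, identified with its edge set. -/
abbrev BGraph (α β : Type*) := Finset (α × β)

section BipartiteDefs

variable {α β : Type*} [DecidableEq α] [DecidableEq β]

/-- Left degree vector. -/
def LD (G : BGraph α β) (a : α) : ℕ := (G.filter fun e => e.1 = a).card

/-- Right degree vector. -/
def RD (G : BGraph α β) (b : β) : ℕ := (G.filter fun e => e.2 = b).card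

/-- The simple graph on `α ⊕ β` associated to a bipartite edge set. -/
def toGraph (G : BGraph α β) : SimpleGraph (α ⊕ β) :=
  SimpleGraph.fromRel fun x y => ∃ a b, x = Sum.inl a ∧ y = Sum.inr b ∧ (a, b) ∈ G

/-- Acyclicity of a bipartite edge set. -/
def Acyclic (G : BGraph α β) : Prop := (toGraph G).IsAcyclic

/-- `U` is a tree on the vertex set `I ⊔ J`. -/
def IsTreeOn (U : BGraph α β) (I : Finset α) (J : Finset β) : Prop :=
  (∀ e ∈ U, e.1 ∈ I ∧ e.2 ∈ J) ∧ Acyclic U ∧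
    ∀ x y : α ⊕ β, Sum.elim (· ∈ I) (· ∈ J) x → Sum.elim (· ∈ I) (· ∈ J) y →
      (toGraph U).Reachable x y

/-- `M` is a perfect matching between `I` and `J`. -/
def IsMatching (M : BGraph α β) (I : Finset α) (J : Finset β) : Prop :=
  (∀ e ∈ M, e.1 ∈ I ∧ e.2 ∈ J) ∧ (∀ a ∈ I, ∃! b : β, (a, b) ∈ M) ∧
    ∀ b ∈ J, ∃! a : α, (a, b) ∈ M

/-- Compatibility of two bipartite graphs. -/
def Compatible (G G' : BGraph α β) : Prop :=
  ∀ (I : Finset α) (J : Finset β) (M M' : BGraph α β),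
    M ⊆ G → M' ⊆ G' → IsMatching M I J → IsMatching M' I J → M = M'

end BipartiteDefs

section TopeDefs

variable {n d : ℕ}

/-- The graph of a tope `T : [n] → [d]`. -/
def topeGraph (T : Fin n → Fin d) : BGraph (Fin n) (Fin d) :=
  Finset.univ.image fun i => (i, T i)

/-- The position (right degree vector) of a tope. -/
def topePos (T : Fin n → Fin d) : Fin d → ℕ :=
  fun j => (Finset.univ.filter fun i => T i = j).card

/-- Standard unit vector `e_j`. -/
def unitVec (j : Fin d) : Fin d → ℕ := fun k => if k = j then 1 else 0

end TopeDefs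

/-- Two edge sets differ in exactly one edge. -/
def diffOne {α β : Type*} [DecidableEq α] [DecidableEq β] (A B : BGraph α β) : Prop :=
  (A \ B).card = 1 ∧ (B \ A).card = 1

/-- The tree-linkage graph `G(t)` on the vertex set `[d]`. -/
def TLGraph {n d : ℕ} (Tr : (Fin d → ℕ) → BGraph (Fin n) (Fin d)) (t : Fin d → ℕ) :
    SimpleGraph (Fin d) :=
  SimpleGraph.fromRel fun j j' => diffOne (Tr (t + unitVec j)) (Tr (t + unitVec j'))

/-- The intersection `T_t` of the trees at positions `t + e_j`, `j ∈ [d]`. -/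
def interTree {n d : ℕ} (Tr : (Fin d → ℕ) → BGraph (Fin n) (Fin d)) (t : Fin d → ℕ) :
    BGraph (Fin n) (Fin d) :=
  Finset.univ.filter fun e => ∀ j : Fin d, e ∈ Tr (t + unitVec j)


section Helpers

open SimpleGraph

variable {α β : Type*} [DecidableEq α] [DecidableEq β]

theorem tg_adj (G : BGraph α β) (a : α) (b : β) :
    (toGraph G).Adj (Sum.inl a) (Sum.inr b) ↔ (a, b) ∈ G := by
  simp [toGraph, SimpleGraph.fromRel_adj]

theorem tg_adj' (G : BGraph α β) (a : α) (b : β) :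
    (toGraph G).Adj (Sum.inr b) (Sum.inl a) ↔ (a, b) ∈ G := by
  rw [SimpleGraph.adj_comm, tg_adj]

theorem tg_ll (G : BGraph α β) (a a' : α) :
    ¬ (toGraph G).Adj (Sum.inl a) (Sum.inl a') := by
  simp [toGraph, SimpleGraph.fromRel_adj]

theorem tg_rr (G : BGraph α β) (b b' : β) :
    ¬ (toGraph G).Adj (Sum.inr b) (Sum.inr b') := by
  simp [toGraph, SimpleGraph.fromRel_adj]

theorem tg_mono {G H : BGraph α β} (h : G ⊆ H) : toGraph G ≤ toGraph H := by
  intro x y hxy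
  rcases x with a | b <;> rcases y with a' | b'
  · exact absurd hxy (tg_ll _ _ _)
  · rw [tg_adj] at *; exact h hxy
  · rw [tg_adj'] at *; exact h hxy
  · exact absurd hxy (tg_rr _ _ _)

theorem tg_erase_adj {T : BGraph α β} {i : α} {j : β} {x y : α ⊕ β}
    (h : (toGraph T).Adj x y) (h1 : ¬ (x = Sum.inl i ∧ y = Sum.inr j))
    (h2 : ¬ (x = Sum.inr j ∧ y = Sum.inl i)) : (toGraph (T.erase (i, j))).Adj x y := by
  rcases x with a | b <;> rcases y with a' | b'
  · exact absurd h (tg_ll _ _ _)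
  · rw [tg_adj] at *
    refine Finset.mem_erase.2 ⟨?_, h⟩
    rintro he; cases he; exact h1 ⟨rfl, rfl⟩
  · rw [tg_adj'] at *
    refine Finset.mem_erase.2 ⟨?_, h⟩
    rintro he; cases he; exact h2 ⟨rfl, rfl⟩
  · exact absurd h (tg_rr _ _ _)

/-- Reachability transfer. -/
theorem reach_transfer {V : Type*} {G H : SimpleGraph V} {u v : V} (h : G.Reachable u v)
    (hG : ∀ x y, G.Reachable u x → G.Adj x y → H.Adj x y) : H.Reachable u v := by
  have key : G.Reachable u v ∧ H.Reachable u v := by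
    have h' := (SimpleGraph.reachable_iff_reflTransGen u v).1 h
    induction h' with
    | refl => exact ⟨Reachable.refl _, Reachable.refl _⟩
    | tail hab hbc ih =>
      obtain ⟨h1, h2⟩ := ih ((SimpleGraph.reachable_iff_reflTransGen _ _).2 hab)
      exact ⟨h1.trans hbc.reachable, h2.trans (hG _ _ h1 hbc).reachable⟩
  exact key.2

/-- Orientation of a rooted forest. -/
theorem orient {V : Type*} [DecidableEq V] (G : SimpleGraph V) (hG : G.IsAcyclic) (ρ : V → V)
    (hr : ∀ v, G.Reachable v (ρ v)) (hc : ∀ u v, G.Adj u v → ρ u = ρ v) :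
    ∃ nxt : V → V, (∀ v, v ≠ ρ v → G.Adj v (nxt v)) ∧ (∀ v, v = ρ v → nxt v = v) ∧
      ∀ u v, G.Adj u v → (nxt u = v ↔ nxt v ≠ u) := by
  have hp : ∀ v, ∃ p : G.Walk v (ρ v), p.IsPath := fun v => (hr v).exists_isPath
  choose p hp using hp
  have huniq : ∀ v (q : G.Walk v (ρ v)), q.IsPath → q = p v := fun v q hq =>
    congrArg Subtype.val (hG.path_unique ⟨q, hq⟩ ⟨p v, hp v⟩)
  have huniq' : ∀ v r (q : G.Walk v r), r = ρ v → q.IsPath → q.snd = (p v).snd := by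
    intro v r q hr hq
    subst hr
    rw [huniq v q hq]
  have hcases : ∀ u v, G.Adj u v → u ∉ (p v).support → (p u).snd = v ∧ (p v).snd ≠ u := by
    intro u v h hu
    constructor
    · have := huniq' u _ (Walk.cons h (p v)) (hc u v h).symm ((p v).cons_isPath_iff h |>.2 ⟨hp v, hu⟩)
      rw [← this]; simp
    · intro h'; apply hu; rw [← h']; exact Walk.getVert_mem_support _ _
  refine ⟨fun v => (p v).snd, ?_, ?_, ?_⟩
  · intro v hv
    exact Walk.adj_snd (Walk.not_nil_of_ne hv)
  · intro v hv
    exact (huniq' v v Walk.nil hv (by simp)).symm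
  · intro u v h
    by_cases hu : u ∈ (p v).support
    · have hv : v ∉ (p u).support := by
        have hq : ((p v).dropUntil u hu).IsPath := (hp v).dropUntil hu
        intro hv
        by_cases hu2 : v ∈ ((p v).dropUntil u hu).support
        · have h1 := (p v).take_spec hu
          have hpv := hp v
          rw [← h1] at hpv
          exact hpv.ne_of_mem_support_of_append h.ne.symm (Walk.start_mem_support _) hu2 rfl
        · have e : ∀ r (q : G.Walk u r), r = ρ u → q.IsPath → q.support = (p u).support := by
            intro r q hr hq; subst hr; rw [huniq u q hq]
          rw [e _ _ (hc u v h).symm hq] at hu2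
          exact hu2 hv
      obtain ⟨h1, h2⟩ := hcases v u h.symm hv
      exact ⟨fun h3 => absurd h3 h2, fun h3 => absurd h1 h3⟩
    · obtain ⟨h1, h2⟩ := hcases u v h hu
      exact ⟨fun _ => h2, fun _ => h1⟩

theorem func_eq {α β : Type*} [DecidableEq α] [DecidableEq β] [Fintype α] (T T' : BGraph α β)
    (hc : Compatible T T') (f g : α → β)
    (hf : ∀ a, (a, f a) ∈ T) (hg : ∀ a, (a, g a) ∈ T')
    (hfib : ∀ b, (univ.filter fun a => f a = b).card = (univ.filter fun a => g a = b).card) :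
    f = g := by
  by_contra hne
  set D : Finset α := univ.filter fun a => f a ≠ g a with hD
  have hDne : D.Nonempty := by
    obtain ⟨a, ha⟩ := Function.ne_iff.1 hne
    exact ⟨a, by simp [hD, ha]⟩
  have hfibD : ∀ b, (D.filter fun a => f a = b).card = (D.filter fun a => g a = b).card := by
    intro b
    have split : ∀ h : α → β, (univ.filter fun a => h a = b).card =
        (D.filter fun a => h a = b).card + (univ.filter fun a => f a = g a ∧ h a = b).card := by
      intro h
      rw [← Finset.card_union_of_disjoint]
      · congr 1; ext a; simp [hD]; tauto
      · rw [Finset.disjoint_left]; intro a; simp [hD]; tauto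
    have h1 := split f
    have h2 := split g
    have h3 : (univ.filter fun a => f a = g a ∧ f a = b) = (univ.filter fun a => f a = g a ∧ g a = b) := by
      ext a; simp; intro h; rw [h]
    rw [h3] at h1
    have := hfib b
    omega
  have hτ : ∀ b, b ∈ D.image f → ∃ a ∈ D, g a = b := by
    intro b hb
    obtain ⟨a, ha, rfl⟩ := Finset.mem_image.1 hb
    have : 0 < (D.filter fun a' => f a' = f a).card := Finset.card_pos.2 ⟨a, by simp [ha]⟩
    rw [hfibD] at this
    obtain ⟨a', ha'⟩ := Finset.card_pos.1 this
    exact ⟨a', (Finset.mem_filter.1 ha').1, (Finset.mem_filter.1 ha').2⟩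
  haveI : Nonempty α := ⟨hDne.choose⟩
  choose! τ hτD hτg using hτ
  set φ : β → β := fun b => f (τ b)
  have hex : ∃ O : Finset β, O ⊆ D.image f ∧ O.Nonempty ∧ O.image φ = O := by
    set P := ((D.image f).powerset.filter fun s => s.Nonempty ∧ s.image φ ⊆ s) with hP
    have hPne : P.Nonempty := ⟨D.image f, by
      simp only [hP, Finset.mem_filter, Finset.mem_powerset]
      refine ⟨subset_rfl, hDne.image f, ?_⟩
      intro c hc
      obtain ⟨b, hb, rfl⟩ := Finset.mem_image.1 hc
      exact Finset.mem_image_of_mem _ (hτD b hb)⟩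
    obtain ⟨O, hO, hmin⟩ := Finset.exists_min_image P Finset.card hPne
    simp only [hP, Finset.mem_filter, Finset.mem_powerset] at hO hmin
    refine ⟨O, hO.1, hO.2.1, ?_⟩
    apply Finset.eq_of_subset_of_card_le hO.2.2
    exact hmin _ ⟨hO.2.2.trans hO.1, hO.2.1.image φ, Finset.image_subset_image hO.2.2⟩
  obtain ⟨O, hOD, hOne, hO⟩ := hex
  have hinj : Set.InjOn φ O := Finset.card_image_iff.1 (by rw [hO])
  have hmaps : ∀ b ∈ O, φ b ∈ O := fun b hb => by
    have := Finset.mem_image_of_mem φ hb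
    rwa [hO] at this
  have hgτ : ∀ b ∈ O, g (τ b) = b := fun b hb => hτg b (hOD hb)
  have hτinj : ∀ b ∈ O, ∀ b' ∈ O, τ b = τ b' → b = b' := fun b hb b' hb' h => by
    rw [← hgτ b hb, h, hgτ b' hb']
  have heq := hc (O.image τ) O (O.image fun b => (τ b, φ b)) (O.image fun b => (τ b, b)) ?_ ?_ ?_ ?_
  · obtain ⟨b, hb⟩ := hOne
    have h1 : (τ b, φ b) ∈ O.image fun b => (τ b, b) := by
      rw [← heq]; exact Finset.mem_image_of_mem (fun b => (τ b, φ b)) hb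
    obtain ⟨b', hb', h2⟩ := Finset.mem_image.1 h1
    simp only [Prod.mk.injEq] at h2
    have h3 := hτinj _ hb' _ hb h2.1
    have h4 : f (τ b) ≠ g (τ b) := (Finset.mem_filter.1 (hτD b (hOD hb))).2
    apply h4
    rw [hgτ b hb, ← h3, h3]
    exact h2.2.symm.trans h3
  · intro e he
    obtain ⟨b, hb, rfl⟩ := Finset.mem_image.1 he
    exact hf _
  · intro e he
    obtain ⟨b, hb, rfl⟩ := Finset.mem_image.1 he
    have := hg (τ b)
    rwa [hgτ b hb] at this
  · refine ⟨?_, ?_, ?_⟩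
    · intro e he
      obtain ⟨b, hb, rfl⟩ := Finset.mem_image.1 he
      exact ⟨Finset.mem_image_of_mem _ hb, hmaps b hb⟩
    · intro a ha
      obtain ⟨b, hb, rfl⟩ := Finset.mem_image.1 ha
      refine ⟨φ b, Finset.mem_image_of_mem (fun b => (τ b, φ b)) hb, ?_⟩
      intro c hc
      obtain ⟨b', hb', h2⟩ := Finset.mem_image.1 hc
      simp only [Prod.mk.injEq] at h2
      rw [← h2.2, hτinj _ hb' _ hb h2.1]
    · intro c hc
      rw [← hO] at hc
      obtain ⟨b, hb, rfl⟩ := Finset.mem_image.1 hc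
      refine ⟨τ b, Finset.mem_image_of_mem (fun b => (τ b, φ b)) hb, ?_⟩
      intro a ha
      obtain ⟨b', hb', h2⟩ := Finset.mem_image.1 ha
      simp only [Prod.mk.injEq] at h2
      rw [← h2.1, hinj hb' hb h2.2]
  · refine ⟨?_, ?_, ?_⟩
    · intro e he
      obtain ⟨b, hb, rfl⟩ := Finset.mem_image.1 he
      exact ⟨Finset.mem_image_of_mem _ hb, hb⟩
    · intro a ha
      obtain ⟨b, hb, rfl⟩ := Finset.mem_image.1 ha
      refine ⟨b, Finset.mem_image_of_mem (fun b => (τ b, b)) hb, ?_⟩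
      intro c hc
      obtain ⟨b', hb', h2⟩ := Finset.mem_image.1 hc
      simp only [Prod.mk.injEq] at h2
      rw [← h2.2, hτinj _ hb' _ hb h2.1]
    · intro b hb
      refine ⟨τ b, Finset.mem_image_of_mem (fun b => (τ b, b)) hb, ?_⟩
      intro a ha
      obtain ⟨b', hb', h2⟩ := Finset.mem_image.1 ha
      simp only [Prod.mk.injEq] at h2
      rw [← h2.1, h2.2]

/-- The star of a right vertex. -/
def starR [Fintype α] (G : BGraph α β) (b : β) : Finset α := univ.filter fun a => (a, b) ∈ G

theorem mem_starR [Fintype α] (G : BGraph α β) (b : β) (a : α) :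
    a ∈ starR G b ↔ (a, b) ∈ G := by simp [starR]

theorem RD_eq [Fintype α] (G : BGraph α β) (b : β) : RD G b = (starR G b).card := by
  symm
  apply Finset.card_bij (fun a _ => (a, b))
  · intro a ha; simpa [mem_starR] using ha
  · intro a _ a' _ h; exact (Prod.mk.inj h).1
  · rintro ⟨a, c⟩ h
    simp only [Finset.mem_filter] at h
    obtain ⟨h, rfl⟩ := h
    exact ⟨a, by simpa [mem_starR] using h, rfl⟩

theorem orientB [Fintype α] (F : BGraph α β) (hF : Acyclic F) (ρ : α ⊕ β → β)
    (hr : ∀ v, (toGraph F).Reachable v (Sum.inr (ρ v)))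
    (hc : ∀ u v, (toGraph F).Adj u v → ρ u = ρ v) :
    ∃ f : α → β, (∀ a, (a, f a) ∈ F) ∧ (∀ a b, (a, b) ∈ F → ρ (Sum.inr b) = b → f a = b) ∧
      ∀ b, (univ.filter fun a => f a = b).card + 1 =
        RD F b + if ρ (Sum.inr b) = b then 1 else 0 := by
  obtain ⟨nxt, h1, h2, h3⟩ := orient (toGraph F) hF (fun v => Sum.inr (ρ v)) hr
    (fun u v h => by rw [hc u v h])
  have hf : ∀ a, ∃ b, nxt (Sum.inl a) = Sum.inr b ∧ (a, b) ∈ F := by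
    intro a
    have := h1 (Sum.inl a) (by simp)
    rcases hn : nxt (Sum.inl a) with a' | b
    · rw [hn] at this; exact absurd this (tg_ll _ _ _)
    · rw [hn, tg_adj] at this; exact ⟨b, rfl, this⟩
  choose f hfn hfF using hf
  have hkey : ∀ a b, (a, b) ∈ F → (f a = b ↔ nxt (Sum.inr b) ≠ Sum.inl a) := by
    intro a b hab
    rw [← h3 _ _ ((tg_adj F a b).2 hab), hfn]
    simp
  refine ⟨f, hfF, ?_, ?_⟩
  · intro a b hab hb
    rw [hkey a b hab, h2 (Sum.inr b) (by simp [hb])]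
    simp
  · intro b
    rw [RD_eq]
    by_cases hb : ρ (Sum.inr b) = b
    · rw [if_pos hb]
      congr 2
      ext a
      simp only [Finset.mem_filter, Finset.mem_univ, true_and, mem_starR]
      constructor
      · rintro rfl; exact hfF a
      · intro hab; rw [hkey a b hab, h2 (Sum.inr b) (by simp [hb])]; simp
    · rw [if_neg hb]
      have hadj := h1 (Sum.inr b) (by simpa using fun h => hb h.symm)
      obtain ⟨c, hcn⟩ : ∃ c, nxt (Sum.inr b) = Sum.inl c := by
        rcases hn : nxt (Sum.inr b) with a' | b'
        · exact ⟨a', rfl⟩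
        · rw [hn] at hadj; exact absurd hadj (tg_rr _ _ _)
      rw [hcn, tg_adj'] at hadj
      have : (univ.filter fun a => f a = b) = (starR F b).erase c := by
        ext a
        simp only [Finset.mem_filter, Finset.mem_univ, true_and, mem_starR, Finset.mem_erase]
        constructor
        · rintro rfl
          refine ⟨?_, hfF a⟩
          rintro rfl
          exact (hkey _ _ (hfF a)).1 rfl hcn
        · rintro ⟨hac, hab⟩
          rw [hkey a b hab, hcn]
          simpa using fun h => hac h.symm
      rw [this, Finset.card_erase_add_one ((mem_starR _ _ _).2 hadj)]
      rfl

/-- Removing an edge of a tree: everything reaches one of the endpoints. -/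
theorem reach_end {T : BGraph α β} {i : α} {j : β} {v : α ⊕ β}
    (h : (toGraph T).Reachable (Sum.inr j) v) :
    (toGraph (T.erase (i, j))).Reachable v (Sum.inl i) ∨
      (toGraph (T.erase (i, j))).Reachable v (Sum.inr j) := by
  have h' := (SimpleGraph.reachable_iff_reflTransGen _ _).1 h
  clear h
  induction h' with
  | refl => right; exact Reachable.refl _
  | @tail x y hab hbc ih =>
    by_cases c1 : x = Sum.inl i ∧ y = Sum.inr j
    · right; rw [c1.2]
    by_cases c2 : x = Sum.inr j ∧ y = Sum.inl i
    · left; rw [c2.2]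
    have := (tg_erase_adj hbc c1 c2).symm.reachable
    rcases ih with ih | ih
    · left; exact this.trans ih
    · right; exact this.trans ih

/-- The edge `(i,j)` of `T` separates `j` from `k`. -/
def Sepr (T : BGraph α β) (i : α) (j k : β) : Prop :=
  (i, j) ∈ T ∧ ¬ (toGraph (T.erase (i, j))).Reachable (Sum.inr j) (Sum.inr k)

theorem exists_sepr {T : BGraph α β} (hac : Acyclic T) {j k : β} (hjk : j ≠ k)
    (hr : (toGraph T).Reachable (Sum.inr j) (Sum.inr k)) : ∃ i, Sepr T i j k := by
  obtain ⟨p, hp⟩ := hr.exists_isPath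
  cases p with
  | nil => exact absurd rfl hjk
  | @cons _ x _ hadj q =>
    rcases x with i | b
    swap
    · exact absurd hadj (tg_rr _ _ _)
    rw [Walk.cons_isPath_iff] at hp
    refine ⟨i, (tg_adj' _ _ _).1 hadj, ?_⟩
    intro hre
    -- a path in the smaller graph gives a second path
    obtain ⟨p', hp'⟩ := hre.exists_isPath
    have hle : toGraph (T.erase (i, j)) ≤ toGraph T := tg_mono (Finset.erase_subset _ _)
    have heq := hac.path_unique ⟨p'.mapLe hle, hp'.mapLe hle⟩
      ⟨Walk.cons hadj q, (Walk.cons_isPath_iff _ _).2 hp⟩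
    have heq' := congrArg (fun w => w.1.edges) heq
    simp only [Walk.edges_mapLe_eq_edges, Walk.edges_cons] at heq'
    have hm : s(Sum.inr j, Sum.inl i) ∈ p'.edges := by rw [heq']; simp
    have := Walk.adj_of_mem_edges p' hm
    rw [tg_adj'] at this
    simp at this

/-- Key lemma. -/
theorem key_sub [Fintype α] {T T' : BGraph α β} {t : β → ℕ} {j k : β} {i : α}
    (hT : Acyclic T) (hTc : ∀ x y, (toGraph T).Reachable x y)
    (hT' : Acyclic T') (hTc' : ∀ x y, (toGraph T').Reachable x y)
    (hRD : ∀ x, RD T x = t x + 1 + if x = j then 1 else 0)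
    (hRD' : ∀ x, RD T' x = t x + 1 + if x = k then 1 else 0)
    (hcomp : Compatible T T') (hsep : Sepr T i j k) {a : α} {b : β}
    (hab : (a, b) ∈ T.erase (i, j))
    (hb : (toGraph (T.erase (i, j))).Reachable (Sum.inr j) (Sum.inr b)) : (a, b) ∈ T' := by
  classical
  obtain ⟨hij, hnr⟩ := hsep
  set F := T.erase (i, j) with hFdef
  have hFac : Acyclic F := by
    unfold Acyclic
    exact IsAcyclic.anti (tg_mono (Finset.erase_subset _ _)) hT
  have hki : (toGraph F).Reachable (Sum.inr k) (Sum.inl i) := by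
    rcases reach_end (i := i) (hTc (Sum.inr j) (Sum.inr k)) with h | h
    · exact h
    · exact absurd h.symm hnr
  have hbk : b ≠ k := by rintro rfl; exact hnr hb
  set ρ : α ⊕ β → β := fun v => if (toGraph F).Reachable (Sum.inr j) v then b else k with hρ
  obtain ⟨f, hf1, hf2, hf3⟩ := orientB F hFac ρ
    (by
      intro v
      by_cases h : (toGraph F).Reachable (Sum.inr j) v
      · simp only [hρ, if_pos h]; exact h.symm.trans hb
      · simp only [hρ, if_neg h]
        rcases reach_end (i := i) (hTc (Sum.inr j) v) with h' | h'
        · exact h'.trans hki.symm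
        · exact absurd h'.symm h)
    (by
      intro u v huv
      have : (toGraph F).Reachable (Sum.inr j) u ↔ (toGraph F).Reachable (Sum.inr j) v :=
        ⟨fun h => h.trans huv.reachable, fun h => h.trans huv.symm.reachable⟩
      simp only [hρ, this])
  obtain ⟨g, hg1, hg2, hg3⟩ := orientB T' hT' (fun _ => b) (fun v => hTc' _ _) (fun _ _ _ => rfl)
  have hRF : ∀ x, RD F x = t x + 1 := by
    intro x
    have h := hRD x
    rw [RD_eq] at h ⊢
    by_cases hx : x = j
    · subst hx
      have : starR F x = (starR T x).erase i := by
        ext c; simp [mem_starR, hFdef]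
      rw [this, Finset.card_erase_of_mem ((mem_starR _ _ _).2 hij), h]
      simp
    · have : starR F x = starR T x := by
        ext c; simp [mem_starR, hFdef, hx]
      rw [this, h, if_neg hx]
  have hroot : ∀ x, ρ (Sum.inr x) = x ↔ x = b ∨ x = k := by
    intro x
    simp only [hρ]
    split_ifs with h
    · constructor
      · intro h'; exact Or.inl h'.symm
      · rintro (h' | h')
        · exact h'.symm
        · subst h'; exact absurd h hnr
    · constructor
      · intro h'; exact Or.inr h'.symm
      · rintro (h' | h')
        · subst h'; exact absurd hb h
        · exact h'.symm
  have hfg : f = g := by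
    apply func_eq T T' hcomp f g (fun a => Finset.mem_of_mem_erase (hf1 a)) hg1
    intro x
    have e1 := hf3 x
    have e2 := hg3 x
    rw [hRF] at e1
    rw [hRD'] at e2
    simp only [hroot] at e1
    by_cases hxb : x = b
    · subst hxb
      simp [hbk] at e1 e2
      omega
    · have : ¬ b = x := fun h => hxb h.symm
      simp only [hxb, this, false_or, if_false] at e1 e2
      split_ifs at e1 e2 <;> omega
  have : f a = b := hf2 a b hab ((hroot b).2 (Or.inl rfl))
  rw [← this, hfg]
  exact hg1 a

end Helpers

theorem local_tree {n d : ℕ} (hd : 1 ≤ d) (T : Fin d → BGraph (Fin n) (Fin d)) (t : Fin d → ℕ)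
    (hac : ∀ j, Acyclic (T j)) (hcon : ∀ j x y, (toGraph (T j)).Reachable x y)
    (hRD : ∀ j x, RD (T j) x = t x + 1 + if x = j then 1 else 0)
    (hcomp : ∀ j k, Compatible (T j) (T k)) (Γ : SimpleGraph (Fin d))
    (hadj : ∀ j k, Γ.Adj j k ↔ j ≠ k ∧ diffOne (T j) (T k)) :
    Γ.Connected ∧ Γ.IsAcyclic := by
  classical
  have hex : ∀ x j : Fin d, ∃ i : Fin n, x ≠ j → Sepr (T x) i x j := by
    intro x j
    by_cases h : x = j
    · have h1 := hRD x x
      rw [RD_eq] at h1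
      have : 0 < (starR (T x) x).card := by omega
      obtain ⟨i, _⟩ := Finset.card_pos.1 this
      exact ⟨i, fun h' => absurd h h'⟩
    · obtain ⟨i, hi⟩ := exists_sepr (hac x) h (hcon x _ _)
      exact ⟨i, fun _ => hi⟩
  choose B hB using hex
  have hK : ∀ {x j : Fin d} {i : Fin n}, Sepr (T x) i x j → ∀ {a b},
      (a, b) ∈ (T x).erase (i, x) →
      (toGraph ((T x).erase (i, x))).Reachable (Sum.inr x) (Sum.inr b) → (a, b) ∈ T j :=
    fun {x j i} hs {a b} hab hb => key_sub (hac x) (hcon x) (hac j) (hcon j) (hRD x) (hRD j)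
      (hcomp x j) hs hab hb
  -- stars
  have hstar' : ∀ {x j : Fin d} {i : Fin n}, x ≠ j → Sepr (T x) i x j →
      (starR (T x) x).erase i = starR (T j) x := by
    intro x j i hxj hs
    apply Finset.eq_of_subset_of_card_le
    · intro a ha
      rw [Finset.mem_erase, mem_starR] at ha
      rw [mem_starR]
      apply hK hs _ (SimpleGraph.Reachable.refl _)
      simp [ha.1, ha.2]
    · have h1 := hRD x x
      have h2 := hRD j x
      rw [RD_eq] at h1 h2
      rw [Finset.card_erase_of_mem ((mem_starR _ _ _).2 hs.1)]
      simp [hxj] at h1 h2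
      omega
  have hmem : ∀ {x j : Fin d}, x ≠ j → ∀ a, ((a, x) ∈ T j ↔ a ≠ B x j ∧ (a, x) ∈ T x) := by
    intro x j hxj a
    rw [← mem_starR, ← hstar' hxj (hB x j hxj), Finset.mem_erase, mem_starR]
  have hBm : ∀ {x j : Fin d}, x ≠ j → (B x j, x) ∈ T x := fun {x j} h => (hB x j h).1
  have huniq : ∀ {x j : Fin d} {i : Fin n}, x ≠ j → Sepr (T x) i x j → i = B x j := by
    intro x j i hxj hs
    by_contra hne
    have h1 : (i, x) ∈ T j := (hmem hxj i).2 ⟨hne, hs.1⟩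
    rw [← mem_starR, ← hstar' hxj hs] at h1
    simp at h1
  -- betweenness axiom
  have hbt : ∀ {j l m : Fin d}, j ≠ l → j ≠ m → B j l ≠ B j m → B l j = B l m := by
    intro j l m hjl hjm hne
    have hlm : l ≠ m := by rintro rfl; exact hne rfl
    have hs := hB j l hjl
    have hs2 := hB l j hjl.symm
    apply huniq hlm
    refine ⟨hs2.1, fun hr => hs2.2 ?_⟩
    have hjmr : (toGraph ((T j).erase (B j l, j))).Reachable (Sum.inr j) (Sum.inr m) := by
      by_contra hcon'
      exact hne (huniq hjm ⟨hs.1, hcon'⟩)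
    have htr : (toGraph ((T l).erase (B l j, l))).Reachable (Sum.inr j) (Sum.inr m) := by
      apply reach_transfer hjmr
      intro x y hx hxy
      have hy := hx.trans hxy.reachable
      have main : ∀ a b, (a, b) ∈ (T j).erase (B j l, j) →
          (toGraph ((T j).erase (B j l, j))).Reachable (Sum.inr j) (Sum.inr b) →
          (a, b) ∈ (T l).erase (B l j, l) := by
        intro a b hab hb
        refine Finset.mem_erase.2 ⟨?_, hK hs hab hb⟩
        intro he
        have : b = l := (Prod.mk.inj he).2
        subst this
        exact hs.2 hb
      rcases x with a | b <;> rcases y with a' | b'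
      · exact absurd hxy (tg_ll _ _ _)
      · rw [tg_adj] at *; exact main _ _ hxy hy
      · rw [tg_adj'] at *; exact main _ _ hxy hx
      · exact absurd hxy (tg_rr _ _ _)
    exact hr.trans htr.symm
  -- characterisation of adjacency
  have hsd : ∀ {j k : Fin d}, j ≠ k → (∀ x, x ≠ j → x ≠ k → B x j = B x k) →
      T j \ T k = {(B j k, j)} := by
    intro j k hjk h
    ext ⟨a, b⟩
    rw [Finset.mem_sdiff, Finset.mem_singleton, Prod.mk.injEq]
    by_cases hbj : b = j
    · subst hbj
      rw [hmem hjk]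
      have := hBm hjk
      constructor
      · rintro ⟨h1, h2⟩
        refine ⟨?_, rfl⟩
        by_contra h3
        exact h2 ⟨h3, h1⟩
      · rintro ⟨rfl, _⟩
        exact ⟨this, fun h => h.1 rfl⟩
    · constructor
      · rintro ⟨h1, h2⟩
        exfalso
        by_cases hbk : b = k
        · subst hbk
          exact h2 ((hmem hbj a).1 h1).2
        · rw [hmem hbj] at h1
          rw [hmem hbk, ← h b hbj hbk] at h2
          exact h2 h1
      · rintro ⟨_, h2⟩; exact absurd h2 hbj
  have hadj1 : ∀ {j k : Fin d}, j ≠ k → (∀ x, x ≠ j → x ≠ k → B x j = B x k) → Γ.Adj j k := by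
    intro j k hjk h
    rw [hadj]
    refine ⟨hjk, ?_, ?_⟩
    · rw [hsd hjk h]; simp
    · rw [hsd hjk.symm (fun x h1 h2 => (h x h2 h1).symm)]; simp
  have hadj2 : ∀ {j k : Fin d}, Γ.Adj j k → ∀ x, x ≠ j → x ≠ k → B x j = B x k := by
    intro j k h x hxj hxk
    obtain ⟨hjk, h1, h2⟩ := (hadj j k).1 h
    by_contra hne
    -- the edge (B x k, x) lies in T j but not in T k
    have hm1 : (B x k, x) ∈ T j \ T k := by
      rw [Finset.mem_sdiff, hmem hxj, hmem hxk]
      exact ⟨⟨fun h => hne h.symm, hBm hxk⟩, fun h => h.1 rfl⟩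
    have hm2 : (B j k, j) ∈ T j \ T k := by
      rw [Finset.mem_sdiff, hmem hjk]
      exact ⟨hBm hjk, fun h => h.1 rfl⟩
    have := Finset.card_le_one.1 h1.le _ hm1 _ hm2
    exact hxj (Prod.mk.inj this).2
  -- uniqueness of links
  have hlinkU : ∀ {v k k' : Fin d}, Γ.Adj v k → Γ.Adj v k' → B v k = B v k' → k = k' := by
    intro v k k' h1 h2 heq
    by_contra hkk
    have hvk := h1.ne
    have hvk' := h2.ne
    have hr : ∀ m, v ≠ m → B v m = B v k →
        (toGraph ((T v).erase (B v k, v))).Reachable (Sum.inr m) (Sum.inl (B v k)) := by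
      intro m hm hBe
      have hs := hB v m hm
      rw [hBe] at hs
      rcases reach_end (i := B v k) (hcon v (Sum.inr v) (Sum.inr m)) with h | h
      · exact h
      · exact absurd h.symm hs.2
    have hkk'r := (hr k hvk rfl).trans (hr k' hvk' heq.symm).symm
    have hβ : B k v = B k k' := hadj2 h2 k hvk.symm hkk
    have hs := hB k k' hkk
    apply hs.2
    refine SimpleGraph.Reachable.mono (tg_mono ?_) hkk'r
    intro e he
    rw [Finset.mem_erase] at he
    rw [Finset.mem_erase]
    constructor
    · rintro rfl
      have := (hmem hvk.symm _).1 he.2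
      exact this.1 hβ.symm
    · by_contra hnot
      have : e ∈ T v \ T k := Finset.mem_sdiff.2 ⟨he.2, hnot⟩
      rw [hsd hvk (hadj2 h1), Finset.mem_singleton] at this
      exact he.1 this
  constructor
  · have hreach : ∀ N : ℕ, ∀ l m : Fin d,
        (univ.filter fun x => x ≠ l ∧ x ≠ m ∧ B x l ≠ B x m).card ≤ N → Γ.Reachable l m := by
      intro N
      induction N using Nat.strong_induction_on with
      | _ N ih =>
        intro l m hN
        by_cases hlm : l = m
        · subst hlm; exact SimpleGraph.Reachable.refl _
        by_cases hb : ∀ x, x ≠ l → x ≠ m → B x l = B x m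
        · exact (hadj1 hlm hb).reachable
        push Not at hb
        obtain ⟨j, hjl, hjm, hj⟩ := hb
        have hdec : ∀ l m : Fin d, j ≠ l → j ≠ m → B j l ≠ B j m →
            (univ.filter fun x => x ≠ l ∧ x ≠ j ∧ B x l ≠ B x j) ⊂
            (univ.filter fun x => x ≠ l ∧ x ≠ m ∧ B x l ≠ B x m) := by
          intro l m hjl hjm hj
          rw [Finset.ssubset_iff_of_subset]
          · exact ⟨j, by simp [hjl, hjm, hj], by simp⟩
          · intro x
            simp only [Finset.mem_filter, Finset.mem_univ, true_and]
            rintro ⟨hxl, hxj, hx⟩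
            have e1 : B j x = B j l := hbt hxj hxl hx.symm
            have hxm : x ≠ m := by
              rintro rfl
              exact hj e1.symm
            refine ⟨hxl, hxm, ?_⟩
            intro hlm'
            rw [hlm'] at hx
            have e2 : B j x = B j m := hbt hxj hxm hx.symm
            exact hj (e1.symm.trans e2)
        have c1 := Finset.card_lt_card (hdec l m hjl hjm hj)
        have c2 := Finset.card_lt_card (hdec m l hjm hjl hj.symm)
        have hsym : (univ.filter fun x => x ≠ m ∧ x ≠ l ∧ B x m ≠ B x l) =
            (univ.filter fun x => x ≠ l ∧ x ≠ m ∧ B x l ≠ B x m) := by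
          ext x
          simp only [Finset.mem_filter, Finset.mem_univ, true_and, ne_comm (a := B x m)]
          tauto
        rw [hsym] at c2
        have r1 := ih _ (lt_of_lt_of_le c1 hN) l j le_rfl
        have r2 := ih _ (lt_of_lt_of_le c2 hN) m j le_rfl
        exact r1.trans r2.symm
    haveI : Nonempty (Fin d) := ⟨⟨0, hd⟩⟩
    exact ⟨fun l m => hreach _ l m le_rfl⟩
  · rw [SimpleGraph.isAcyclic_iff_forall_adj_isBridge]
    intro v w hvw
    rw [SimpleGraph.isBridge_iff]
    intro hr
    have key : ∀ x, (Γ \ SimpleGraph.fromEdgeSet {s(v, w)}).Reachable w x →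
        x ≠ v ∧ B v x = B v w := by
      intro x hx
      have hx' := (SimpleGraph.reachable_iff_reflTransGen _ _).1 hx
      clear hx
      induction hx' with
      | refl => exact ⟨hvw.ne.symm, rfl⟩
      | @tail y z _ hyz ih =>
        obtain ⟨hy, hBy⟩ := ih
        rw [SimpleGraph.sdiff_adj, SimpleGraph.fromEdgeSet_adj] at hyz
        obtain ⟨hyz, hne⟩ := hyz
        have hz : z ≠ v := by
          rintro rfl
          have hyw : y = w := hlinkU hyz.symm hvw hBy
          subst hyw
          exact hne ⟨by simp [Sym2.eq_swap], hyz.ne⟩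
        exact ⟨hz, (hadj2 hyz v hy.symm hz.symm).symm.trans hBy⟩
    exact (key v hr.symm).1 rfl

theorem statement5 {n d : ℕ} (hn : 2 ≤ n) (hd : 1 ≤ d)
    (Tr : (Fin d → ℕ) → BGraph (Fin n) (Fin d))
    (htree : ∀ u : Fin d → ℕ, (∑ j, u j) + 1 = n → IsTreeOn (Tr u) Finset.univ Finset.univ)
    (hRDeg : ∀ u : Fin d → ℕ, (∑ j, u j) + 1 = n → ∀ j, RD (Tr u) j = u j + 1)
    (hcompat : ∀ u u' : Fin d → ℕ, (∑ j, u j) + 1 = n → (∑ j, u' j) + 1 = n →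
      Compatible (Tr u) (Tr u'))
    (hlink : ∀ u : Fin d → ℕ, (∑ j, u j) + 1 = n → ∀ e ∈ Tr u,
      2 ≤ LD (Tr u) e.1 → 2 ≤ RD (Tr u) e.2 →
      ∃ u' : Fin d → ℕ, ((∑ j, u' j) + 1 = n) ∧ ∃ e' ∈ Tr u',
        (Tr u).erase e = (Tr u').erase e')
    (t : Fin d → ℕ) (ht : (∑ j, t j) + 2 = n) :
    (TLGraph Tr t).Connected ∧ (TLGraph Tr t).IsAcyclic := by
  classical
  -- the local family of trees
  set T : Fin d → BGraph (Fin n) (Fin d) := fun j => Tr (t + unitVec j) with hTdef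
  have hsum : ∀ j : Fin d, (∑ k, (t + unitVec j) k) + 1 = n := by
    intro j
    have : ∑ k, (t + unitVec j) k = (∑ k, t k) + 1 := by
      simp [Finset.sum_add_distrib, unitVec]
    omega
  have hac : ∀ j, Acyclic (T j) := fun j => (htree _ (hsum j)).2.1
  have hcon : ∀ j x y, (toGraph (T j)).Reachable x y := by
    intro j x y
    apply (htree _ (hsum j)).2.2 x y
    · rcases x with x | x <;> simp
    · rcases y with y | y <;> simp
  have hRD : ∀ j x, RD (T j) x = t x + 1 + if x = j then 1 else 0 := by
    intro j x
    have := hRDeg _ (hsum j) x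
    simp only [hTdef, this, Pi.add_apply, unitVec]
    omega
  have hcomp : ∀ j k, Compatible (T j) (T k) := fun j k => hcompat _ _ (hsum j) (hsum k)
  have hadj : ∀ j k, (TLGraph Tr t).Adj j k ↔ j ≠ k ∧ diffOne (T j) (T k) := by
    intro j k
    simp only [TLGraph, SimpleGraph.fromRel_adj, hTdef, diffOne]
    tauto
  clear_value T
  exact local_tree hd T t hac hcon hRD hcomp _ hadj
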